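/- arXiv:2605.08007 — 2 statements merged into one kernel-verified Lean document; each statement's English description precedes it below -/
import Mathlib

section
/- Let (W, F, ν) be a measure space, U ∈ F, φ : W → ℝ≥0 measurable, and let n, β > 0. Let G, G¹, O : W → ℝ be measurable functions that are bounded on U, and suppose 0 < Z⁰ := ∫_U exp(−nβ G(w)) φ(w) dν < ∞. For h ∈ ℝ define the affine deformation G^h = G + h(G¹ − G), the perturbed evidence Z^h = ∫_U exp(−nβ G^h(w)) φ(w) dν, and the perturbed posterior expectation ⟨O⟩_h = (1/Z^h) ∫_U O(w) exp(−nβ G^h(w)) φ(w) dν. Then the function h ↦ ⟨O⟩_h is differentiable at h = 0 and (1/(nβ)) (d/dh)|_{h=0} ⟨O⟩_h = Cov_{μ}(O, G − G¹), where μ is the probability measure on U with density exp(−nβ G) φ / Z⁰ with respect to ν and Cov_μ(X,Y) = ⟨XY⟩_μ − ⟨X⟩_μ ⟨Y⟩_μ. -/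
open MeasureTheory

/-- Differentiation under the integral of an exponential tilt, by a bounded function, of an
integrable density. -/
theorem hasDerivAt_integral_exp_mul_zero {W : Type*} [MeasurableSpace W] {μ : Measure W}
    {X p : W → ℝ} {C : ℝ} (hX : AEStronglyMeasurable X μ) (hXC : ∀ᵐ w ∂μ, |X w| ≤ C)
    (hp : Integrable p μ) :
    HasDerivAt (fun h : ℝ => ∫ w, Real.exp (h * X w) * p w ∂μ) (∫ w, X w * p w ∂μ) 0 := by
  have hmeas (h : ℝ) : AEStronglyMeasurable (fun w => Real.exp (h * X w) * p w) μ :=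
    (Real.continuous_exp.comp_aestronglyMeasurable (hX.const_mul h)).mul hp.1
  have key := (hasDerivAt_integral_of_dominated_loc_of_deriv_le (μ := μ)
    (F := fun h w => Real.exp (h * X w) * p w)
    (F' := fun h w => Real.exp (h * X w) * X w * p w)
    (bound := fun w => Real.exp C * C * |p w|) (x₀ := (0 : ℝ))
    (Metric.ball_mem_nhds 0 one_pos) (.of_forall hmeas) (by simpa using hp)
    (by simpa using! hX.mul hp.1) ?_ (hp.abs.const_mul _) ?_).2
  · simpa using key
  · filter_upwards [hXC] with w hw h hh
    have hh' : |h| ≤ 1 := by simpa using (Metric.mem_ball.mp hh).le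
    have hC : 0 ≤ C := (abs_nonneg _).trans hw
    have hle : h * X w ≤ C := calc
      h * X w ≤ |h| * |X w| := (le_abs_self _).trans (abs_mul _ _).le
      _ ≤ 1 * C := by gcongr
      _ = C := one_mul C
    rw [Real.norm_eq_abs, abs_mul, abs_mul, Real.abs_exp]
    gcongr
  · refine .of_forall fun w h _ => ?_
    simpa using (((hasDerivAt_id h).mul_const (X w)).exp).mul_const (p w)

/-- fluctuation–dissipation formula for susceptibilities,
observable not depending on the deformation parameter.
The posterior expectation `⟨O⟩_h` of `O` under the posterior with density proportional to
`exp(-nβ G^h) φ` on `U`, for the affine deformation `G^h = G + h (G¹ - G)`, is differentiable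
at `h = 0`, and `(1/(nβ)) (d/dh)|₀ ⟨O⟩_h = Cov_μ(O, G - G¹)` where `μ` is the posterior
at `h = 0` (expectations of a function `f` under `μ` being
`(1/Z⁰) ∫_U f · exp(-nβ G) φ dν`). -/
theorem stmt_0
    {W : Type*} [MeasurableSpace W] (ν : Measure W)
    (U : Set W) (hU : MeasurableSet U)
    (φ : W → ℝ) (hφmeas : Measurable φ) (hφ0 : ∀ w, 0 ≤ φ w)
    (n β : ℝ) (hn : 0 < n) (hβ : 0 < β)
    (G G1 O : W → ℝ)
    (hGmeas : Measurable G) (hG1meas : Measurable G1) (hOmeas : Measurable O)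
    (hGbdd : ∃ M, ∀ w ∈ U, |G w| ≤ M)
    (hG1bdd : ∃ M, ∀ w ∈ U, |G1 w| ≤ M)
    (hObdd : ∃ M, ∀ w ∈ U, |O w| ≤ M)
    (Z0 : ℝ)
    (hZ0 : Z0 = ∫ w in U, Real.exp (-(n * β) * G w) * φ w ∂ν)
    (hZ0pos : 0 < Z0)
    (hZ0fin : Integrable (fun w => Real.exp (-(n * β) * G w) * φ w) (ν.restrict U)) :
    HasDerivAt
      (fun h : ℝ =>
        (∫ w in U, O w * Real.exp (-(n * β) * (G w + h * (G1 w - G w))) * φ w ∂ν) /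
        (∫ w in U, Real.exp (-(n * β) * (G w + h * (G1 w - G w))) * φ w ∂ν))
      (n * β *
        ((1 / Z0) * (∫ w in U, O w * (G w - G1 w) * Real.exp (-(n * β) * G w) * φ w ∂ν) -
          ((1 / Z0) * (∫ w in U, O w * Real.exp (-(n * β) * G w) * φ w ∂ν)) *
          ((1 / Z0) * (∫ w in U, (G w - G1 w) * Real.exp (-(n * β) * G w) * φ w ∂ν))))
      0 := by
  obtain ⟨A, hA⟩ := hGbdd
  obtain ⟨B, hB⟩ := hG1bdd
  obtain ⟨K, hK⟩ := hObdd
  have hX : AEStronglyMeasurable (fun w => n * β * (G w - G1 w)) (ν.restrict U) :=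
    ((hGmeas.sub hG1meas).const_mul _).aestronglyMeasurable
  have hXC : ∀ᵐ w ∂ν.restrict U, |n * β * (G w - G1 w)| ≤ n * β * (A + B) := by
    filter_upwards [ae_restrict_mem hU] with w hw
    rw [abs_mul, abs_of_pos (mul_pos hn hβ)]
    gcongr
    exact (abs_sub _ _).trans (add_le_add (hA w hw) (hB w hw))
  have hO : Integrable (fun w => O w * (Real.exp (-(n * β) * G w) * φ w)) (ν.restrict U) := by
    refine hZ0fin.bdd_mul (c := K) hOmeas.aestronglyMeasurable ?_
    filter_upwards [ae_restrict_mem hU] with w hw using hK w hw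
  have hexp (h : ℝ) (w : W) : Real.exp (-(n * β) * (G w + h * (G1 w - G w))) =
      Real.exp (h * (n * β * (G w - G1 w))) * Real.exp (-(n * β) * G w) := by
    rw [← Real.exp_add]
    ring_nf
  have hden := hasDerivAt_integral_exp_mul_zero hX hXC hZ0fin
  have hnum := hasDerivAt_integral_exp_mul_zero hX hXC hO
  have hderiv := hnum.div hden (by simpa only [zero_mul, Real.exp_zero, one_mul, ← hZ0] using hZ0pos.ne')
  refine (hderiv.congr_deriv ?_).congr_of_eventuallyEq (.of_forall fun h => ?_)
  · have hnum' : ∫ w in U, n * β * (G w - G1 w) * (O w * (Real.exp (-(n * β) * G w) * φ w)) ∂ν =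
        n * β * ∫ w in U, O w * (G w - G1 w) * Real.exp (-(n * β) * G w) * φ w ∂ν := by
      rw [← integral_const_mul]
      congr 1 with w
      ring
    have hden' : ∫ w in U, n * β * (G w - G1 w) * (Real.exp (-(n * β) * G w) * φ w) ∂ν =
        n * β * ∫ w in U, (G w - G1 w) * Real.exp (-(n * β) * G w) * φ w ∂ν := by
      rw [← integral_const_mul]
      congr 1 with w
      ring
    rw [hnum', hden']
    simp only [zero_mul, Real.exp_zero, one_mul, ← hZ0, ← mul_assoc (O _)]
    field_simp
  · simp only [hexp, Pi.div_apply]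
    congr 2 <;> funext w <;> ring
end

section
/- Let (W, F, ν) be a measure space, U ∈ F, φ : W → ℝ≥0 measurable, and let n, β > 0. Let G, G¹ : W → ℝ be measurable and bounded on U with 0 < Z⁰ := ∫_U exp(−nβ G(w)) φ(w) dν < ∞, and let G^h = G + h(G¹ − G). Let O : ℝ × W → ℝ be such that w ↦ O(h, w) is measurable for each h, for each w ∈ U the function h ↦ O(h, w) is differentiable on (−δ, δ) for some δ > 0 independent of w, and there exists M with |O(h, w)| ≤ M and |∂_h O(h, w)| ≤ M for all w ∈ U, h ∈ (−δ, δ). Define ⟨·⟩_h using the posterior with density proportional to exp(−nβ G^h) φ on U. Then h ↦ ⟨O(h, ·)⟩_h is differentiable at 0 and (1/(nβ)) (d/dh)|_{h=0} ⟨O(h, ·)⟩_h = Cov_μ(O(0, ·), G − G¹) + (1/(nβ)) ⟨∂_h O(h, ·)|_{h=0}⟩_μ, where μ is the posterior at h = 0. In particular the dependence of the observable on h contributes only at order 1/(nβ). -/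
open MeasureTheory

/-- A pointwise derivative of an almost everywhere strongly measurable family is almost everywhere
strongly measurable. -/
theorem aestronglyMeasurable_of_ae_hasDerivAt {W : Type*} [MeasurableSpace W] {μ : Measure W}
    {f : ℝ → W → ℝ} {f' : W → ℝ} {x : ℝ} (hf : ∀ t, AEStronglyMeasurable (f t) μ)
    (hderiv : ∀ᵐ w ∂μ, HasDerivAt (fun t => f t w) (f' w) x) : AEStronglyMeasurable f' μ := by
  refine aestronglyMeasurable_of_tendsto_ae (nhdsWithin (0 : ℝ) {0}ᶜ)
    (f := fun t w => t⁻¹ • (f (x + t) w - f x w))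
    (fun t => ((hf (x + t)).fun_sub (hf x)).fun_const_smul t⁻¹) ?_
  filter_upwards [hderiv] with w hw using hw.tendsto_slope_zero

/-- Differentiation under the integral sign for an exponentially tilted integrable density `ρ`
with bounded tilt `D` and a bounded observable with bounded derivative. -/
theorem hasDerivAt_integral_mul_exp_tilt {W : Type*} [MeasurableSpace W] {μ : Measure W}
    {D ρ : W → ℝ} {K : ℝ} (hD : AEStronglyMeasurable D μ) (hDbdd : ∀ᵐ w ∂μ, |D w| ≤ K)
    (hρ : Integrable ρ μ) {O O' : ℝ → W → ℝ} (hO : ∀ h, AEStronglyMeasurable (O h) μ)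
    {δ M : ℝ} (hδ : 0 < δ)
    (hderiv : ∀ᵐ w ∂μ, ∀ h ∈ Set.Ioo (-δ) δ, HasDerivAt (fun t => O t w) (O' h w) h)
    (hbdd : ∀ᵐ w ∂μ, ∀ h ∈ Set.Ioo (-δ) δ, |O h w| ≤ M ∧ |O' h w| ≤ M) :
    HasDerivAt (fun h => ∫ w, O h w * Real.exp (h * D w) * ρ w ∂μ)
      ((∫ w, O' 0 w * ρ w ∂μ) + ∫ w, O 0 w * D w * ρ w ∂μ) 0 := by
  have h0 : (0 : ℝ) ∈ Set.Ioo (-δ) δ := ⟨neg_lt_zero.2 hδ, hδ⟩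
  have hO' : AEStronglyMeasurable (O' 0) μ :=
    aestronglyMeasurable_of_ae_hasDerivAt hO (hderiv.mono fun w hw => hw 0 h0)
  have hint : Integrable (fun w => O 0 w * ρ w) μ :=
    hρ.bdd_mul (hO 0) (hbdd.mono fun w hw => (hw 0 h0).1)
  have hint' : Integrable (fun w => O' 0 w * ρ w) μ :=
    hρ.bdd_mul hO' (hbdd.mono fun w hw => (hw 0 h0).2)
  have hintD : Integrable (fun w => O 0 w * D w * ρ w) μ := by
    refine (hint.bdd_mul hD hDbdd).congr (Filter.Eventually.of_forall fun w => ?_)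
    simp only
    ring
  have key := (hasDerivAt_integral_of_dominated_loc_of_deriv_le (μ := μ) (x₀ := (0 : ℝ))
    (F := fun h w => O h w * Real.exp (h * D w) * ρ w)
    (F' := fun h w => (O' h w + O h w * D w) * Real.exp (h * D w) * ρ w)
    (bound := fun w => (M + M * K) * Real.exp (δ * K) * ‖ρ w‖)
    (Ioo_mem_nhds h0.1 h0.2) (Filter.Eventually.of_forall fun h => ?_) ?_ ?_ ?_
    (hρ.norm.const_mul _) ?_).2
  · refine key.congr_deriv ?_
    rw [← integral_add hint' hintD]
    refine integral_congr_ae (Filter.Eventually.of_forall fun w => ?_)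
    simp only [zero_mul, Real.exp_zero, mul_one]
    ring
  · exact ((hO h).mul (Real.continuous_exp.comp_aestronglyMeasurable (hD.const_mul h))).mul
      hρ.aestronglyMeasurable
  · simpa using hint
  · simpa using (hO'.fun_add ((hO 0).fun_mul hD)).fun_mul hρ.aestronglyMeasurable
  · filter_upwards [hbdd, hDbdd] with w hw hDw h hh
    obtain ⟨hOw, hOw'⟩ := hw h hh
    have hM : 0 ≤ M := (abs_nonneg _).trans hOw
    have hexp : h * D w ≤ δ * K := calc
      h * D w ≤ |h| * |D w| := (le_abs_self _).trans_eq (abs_mul _ _)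
      _ ≤ δ * K := mul_le_mul (abs_lt.2 hh).le hDw (abs_nonneg _) hδ.le
    have hfac : |O' h w + O h w * D w| ≤ M + M * K := by
      refine (abs_add_le _ _).trans (add_le_add hOw' ?_)
      rw [abs_mul]
      exact mul_le_mul hOw hDw (abs_nonneg _) hM
    rw [norm_mul, norm_mul, Real.norm_eq_abs (Real.exp _), Real.abs_exp]
    exact mul_le_mul_of_nonneg_right (mul_le_mul hfac (Real.exp_le_exp.2 hexp)
      (Real.exp_nonneg _) ((abs_nonneg _).trans hfac)) (norm_nonneg _)
  · filter_upwards [hderiv] with w hw h hh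
    have hexp : HasDerivAt (fun t => Real.exp (t * D w)) (Real.exp (h * D w) * (1 * D w)) h :=
      ((hasDerivAt_id h).mul_const (D w)).exp
    refine (((hw h hh).fun_mul hexp).mul_const (ρ w)).congr_deriv ?_
    ring

/-- fluctuation–dissipation formula for susceptibilities, general form:
the observable `O(h, ·)` may itself depend on the deformation parameter `h`.
With `G^h = G + h (G¹ - G)` and posterior `⟨·⟩_h` of density proportional to
`exp(-nβ G^h) φ` on `U`, the map `h ↦ ⟨O(h, ·)⟩_h` is differentiable at `0` and
`(1/(nβ)) (d/dh)|₀ ⟨O(h,·)⟩_h = Cov_μ(O(0,·), G - G¹) + (1/(nβ)) ⟨∂ₕO(h,·)|₀⟩_μ`,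
where `μ` is the posterior at `h = 0`. -/
theorem stmt_1
    {W : Type*} [MeasurableSpace W] (ν : Measure W)
    (U : Set W) (hU : MeasurableSet U)
    (φ : W → ℝ) (hφmeas : Measurable φ) (hφ0 : ∀ w, 0 ≤ φ w)
    (n β : ℝ) (hn : 0 < n) (hβ : 0 < β)
    (G G1 : W → ℝ)
    (hGmeas : Measurable G) (hG1meas : Measurable G1)
    (hGbdd : ∃ M, ∀ w ∈ U, |G w| ≤ M)
    (hG1bdd : ∃ M, ∀ w ∈ U, |G1 w| ≤ M)
    (Z0 : ℝ)
    (hZ0 : Z0 = ∫ w in U, Real.exp (-(n * β) * G w) * φ w ∂ν)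
    (hZ0pos : 0 < Z0)
    (hZ0fin : Integrable (fun w => Real.exp (-(n * β) * G w) * φ w) (ν.restrict U))
    (O O' : ℝ → W → ℝ)
    (hOmeas : ∀ h, Measurable (O h))
    (δ : ℝ) (hδ : 0 < δ)
    (hOderiv : ∀ w ∈ U, ∀ h ∈ Set.Ioo (-δ) δ, HasDerivAt (fun t => O t w) (O' h w) h)
    (M : ℝ)
    (hObdd : ∀ w ∈ U, ∀ h ∈ Set.Ioo (-δ) δ, |O h w| ≤ M ∧ |O' h w| ≤ M) :
    HasDerivAt
      (fun h : ℝ =>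
        (∫ w in U, O h w * Real.exp (-(n * β) * (G w + h * (G1 w - G w))) * φ w ∂ν) /
        (∫ w in U, Real.exp (-(n * β) * (G w + h * (G1 w - G w))) * φ w ∂ν))
      (n * β *
        ((1 / Z0) * (∫ w in U, O 0 w * (G w - G1 w) * Real.exp (-(n * β) * G w) * φ w ∂ν) -
          ((1 / Z0) * (∫ w in U, O 0 w * Real.exp (-(n * β) * G w) * φ w ∂ν)) *
          ((1 / Z0) * (∫ w in U, (G w - G1 w) * Real.exp (-(n * β) * G w) * φ w ∂ν)))
        + (1 / Z0) * (∫ w in U, O' 0 w * Real.exp (-(n * β) * G w) * φ w ∂ν))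
      0 := by
  obtain ⟨A, hA⟩ := hGbdd
  obtain ⟨B, hB⟩ := hG1bdd
  set ρ : W → ℝ := fun w => Real.exp (-(n * β) * G w) * φ w with hρ
  set D : W → ℝ := fun w => n * β * (G w - G1 w) with hD
  have hnβ : 0 < n * β := mul_pos hn hβ
  have hDmeas : AEStronglyMeasurable D (ν.restrict U) :=
    ((hGmeas.sub hG1meas).const_mul _).aestronglyMeasurable
  have hDbdd : ∀ᵐ w ∂ν.restrict U, |D w| ≤ n * β * (A + B) := by
    filter_upwards [ae_restrict_mem hU] with w hw
    rw [hD, abs_mul, abs_of_pos hnβ]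
    exact mul_le_mul_of_nonneg_left ((abs_sub _ _).trans (add_le_add (hA w hw) (hB w hw))) hnβ.le
  have hnum := hasDerivAt_integral_mul_exp_tilt hDmeas hDbdd hZ0fin
    (fun h => (hOmeas h).aestronglyMeasurable) hδ
    ((ae_restrict_mem hU).mono hOderiv) ((ae_restrict_mem hU).mono hObdd)
  have hden := hasDerivAt_integral_mul_exp_tilt hDmeas hDbdd hZ0fin
    (O := fun _ _ => 1) (O' := fun _ _ => 0) (M := 1)
    (fun _ => aestronglyMeasurable_const) hδ
    (Filter.Eventually.of_forall fun _ h _ => hasDerivAt_const h 1)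
    (Filter.Eventually.of_forall fun _ _ _ => by simp)
  have htilt (h : ℝ) (w : W) : Real.exp (-(n * β) * (G w + h * (G1 w - G w))) =
      Real.exp (h * D w) * Real.exp (-(n * β) * G w) := by
    rw [← Real.exp_add, hD]
    congr 1
    ring
  have hZ : (∫ w in U, 1 * Real.exp (0 * D w) * ρ w ∂ν) = Z0 := by simp [hZ0, hρ]
  have hquot := hnum.div hden (by simpa only [hZ] using hZ0pos.ne')
  have hcov : (∫ w in U, O 0 w * D w * ρ w ∂ν) =
      n * β * ∫ w in U, O 0 w * (G w - G1 w) * Real.exp (-(n * β) * G w) * φ w ∂ν := by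
    rw [← integral_const_mul]
    congr 1 with w
    simp only [hD, hρ]
    ring
  have hmean : (∫ w in U, 1 * D w * ρ w ∂ν) =
      n * β * ∫ w in U, (G w - G1 w) * Real.exp (-(n * β) * G w) * φ w ∂ν := by
    rw [← integral_const_mul]
    congr 1 with w
    simp only [hD, hρ]
    ring
  refine (hquot.congr_deriv ?_).congr_of_eventuallyEq (Filter.Eventually.of_forall fun h => ?_)
  rotate_left
  · simp only [Pi.div_apply, htilt, hρ, one_mul, mul_assoc]
  · rw [hZ, hcov, hmean]
    simp only [zero_mul, Real.exp_zero, mul_one, integral_zero, zero_add, hρ, ← mul_assoc]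
    field_simp
    ring
end
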